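/- Let X ⊆ ℝⁿ be open, p, q_j, g_j : X → Mat(N,ℂ) smooth for j ≥ 1, and γ_j → γ in X with p(γ) = p(γ_j) = 0 for all j. Assume ∂_{x₁} p(γ) is an invertible matrix, and that there is a smooth q : X → Mat(N,ℂ) with ∂^α q(γ) = lim_j ∂^α q_j(γ_j) for every multi-index α. If q_j − p·g_j vanishes of infinite order at γ_j for every j, then for every multi-index α the limit lim_j ∂^α g_j(γ_j) exists; moreover there is a smooth g : X → Mat(N,ℂ) with ∂^α g(γ) = lim_j ∂^α g_j(γ_j) for all α, and q − p·g vanishes of infinite order at γ. -/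

import Mathlib

open Filter

/-- First-order partial derivative in the `i`-th coordinate direction, within `X`. -/
noncomputable def pderivOn {n : ℕ} (X : Set (Fin n → ℝ)) (i : Fin n)
    (f : (Fin n → ℝ) → ℂ) : (Fin n → ℝ) → ℂ :=
  fun x => fderivWithin ℝ f X x (Pi.single i 1)

/-- Iterated (multi-index) partial derivative `∂^α`, the multi-index being recorded
as a list of coordinate directions. -/
noncomputable def mderivOn {n : ℕ} (X : Set (Fin n → ℝ)) (α : List (Fin n))
    (f : (Fin n → ℝ) → ℂ) : (Fin n → ℝ) → ℂ :=
  α.foldr (pderivOn X) f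

section Scalar

theorem two_le_smooth : (2 : WithTop ℕ∞) ≤ ((⊤ : ℕ∞) : WithTop ℕ∞) :=
  WithTop.coe_le_coe.2 (le_top : (2 : ℕ∞) ≤ ⊤)

variable {n : ℕ} {X : Set (Fin n → ℝ)}

theorem mderivOn_cons (a : Fin n) (α : List (Fin n)) (f : (Fin n → ℝ) → ℂ) :
    mderivOn X (a :: α) f = pderivOn X a (mderivOn X α f) := rfl

theorem pderivOn_congr {f g : (Fin n → ℝ) → ℂ} (h : Set.EqOn f g X) (a : Fin n) :
    Set.EqOn (pderivOn X a f) (pderivOn X a g) X := fun x hx => by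
  simp only [pderivOn, fderivWithin_congr h (h hx)]

theorem ContDiffOn.pderivOn {f : (Fin n → ℝ) → ℂ} (hf : ContDiffOn ℝ (⊤ : ℕ∞) f X)
    (hX : IsOpen X) (a : Fin n) : ContDiffOn ℝ (⊤ : ℕ∞) (pderivOn X a f) X :=
  (hf.fderivWithin hX.uniqueDiffOn (by simp)).clm_apply contDiffOn_const

theorem ContDiffOn.mderivOn {f : (Fin n → ℝ) → ℂ} (hf : ContDiffOn ℝ (⊤ : ℕ∞) f X)
    (hX : IsOpen X) (α : List (Fin n)) : ContDiffOn ℝ (⊤ : ℕ∞) (mderivOn X α f) X := by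
  induction α with
  | nil => exact hf
  | cons a α ih => exact ih.pderivOn hX a

theorem pderivOn_comm {f : (Fin n → ℝ) → ℂ} (hf : ContDiffOn ℝ (⊤ : ℕ∞) f X)
    (hX : IsOpen X) (a b : Fin n) :
    Set.EqOn (pderivOn X a (pderivOn X b f)) (pderivOn X b (pderivOn X a f)) X := by
  intro x hx
  have hd : DifferentiableWithinAt ℝ (fderivWithin ℝ f X) X x :=
    (hf.fderivWithin (m := 1) hX.uniqueDiffOn (by rw [one_add_one_eq_two]; exact two_le_smooth)).differentiableOn
      (by simp) x hx
  have key : ∀ u v : Fin n → ℝ, fderivWithin ℝ (fun y => fderivWithin ℝ f X y u) X x v =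
      fderivWithin ℝ (fderivWithin ℝ f X) X x v u := fun u v => by
    rw [fderivWithin_clm_apply (hX.uniqueDiffWithinAt hx) hd (differentiableWithinAt_const u)]
    simp
  have hsymm : IsSymmSndFDerivWithinAt ℝ f X x :=
    (hf x hx).isSymmSndFDerivWithinAt
      (by simpa using two_le_smooth) hX.uniqueDiffOn
      (by rw [hX.interior_eq]; exact subset_closure hx) hx
  change fderivWithin ℝ (fun y => fderivWithin ℝ f X y _) X x _ =
    fderivWithin ℝ (fun y => fderivWithin ℝ f X y _) X x _
  rw [key, key, hsymm.eq]

theorem mderivOn_perm {f : (Fin n → ℝ) → ℂ} (hf : ContDiffOn ℝ (⊤ : ℕ∞) f X)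
    (hX : IsOpen X) {α β : List (Fin n)} (h : α.Perm β) :
    Set.EqOn (mderivOn X α f) (mderivOn X β f) X := by
  induction h with
  | nil => exact fun _ _ => rfl
  | cons a _ ih => exact pderivOn_congr ih a
  | swap a b l => exact pderivOn_comm (hf.mderivOn hX l) hX b a
  | trans _ _ h₁ h₂ => exact h₁.trans h₂

theorem mderivOn_eq_iteratedFDeriv {f : (Fin n → ℝ) → ℂ} (hf : ContDiffOn ℝ (⊤ : ℕ∞) f X)
    (hX : IsOpen X) (α : List (Fin n)) {x : Fin n → ℝ} (hx : x ∈ X) :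
    mderivOn X α f x = iteratedFDeriv ℝ α.length f x fun i => Pi.single (α.get i) 1 := by
  induction α generalizing x with
  | nil => simp [mderivOn]
  | cons a α ih =>
    have hd : DifferentiableAt ℝ (iteratedFDeriv ℝ α.length f) x :=
      (hf.contDiffAt (hX.mem_nhds hx)).differentiableAt_iteratedFDeriv
        (by exact_mod_cast ENat.natCast_lt_top _)
    have hg : HasFDerivAt (fun y => iteratedFDeriv ℝ α.length f y
        fun i => Pi.single (α.get i) 1) _ x :=
      ((ContinuousMultilinearMap.apply ℝ (fun _ : Fin α.length => Fin n → ℝ) ℂ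
        fun i => Pi.single (α.get i) 1).hasFDerivAt).comp x hd.hasFDerivAt
    rw [mderivOn_cons, pderivOn_congr (fun y hy => ih hy) a hx, pderivOn,
      fderivWithin_of_isOpen hX hx, hg.fderiv]
    rfl

end Scalar

section MatrixValued

variable {n N : ℕ} {X : Set (Fin n → ℝ)}

/-- Smoothness of all entries of a matrix-valued function. -/
def EntrySmoothOn (X : Set (Fin n → ℝ)) (F : (Fin n → ℝ) → Matrix (Fin N) (Fin N) ℂ) : Prop :=
  ∀ i j, ContDiffOn ℝ (⊤ : ℕ∞) (fun x => F x i j) X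

/-- Entrywise first-order partial derivative of a matrix-valued function. -/
noncomputable def matPderivOn (X : Set (Fin n → ℝ)) (a : Fin n)
    (F : (Fin n → ℝ) → Matrix (Fin N) (Fin N) ℂ) : (Fin n → ℝ) → Matrix (Fin N) (Fin N) ℂ :=
  fun x => Matrix.of fun i j => pderivOn X a (fun y => F y i j) x

/-- Entrywise iterated partial derivative of a matrix-valued function. -/
noncomputable def matMderivOn (X : Set (Fin n → ℝ)) (α : List (Fin n))
    (F : (Fin n → ℝ) → Matrix (Fin N) (Fin N) ℂ) : (Fin n → ℝ) → Matrix (Fin N) (Fin N) ℂ :=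
  α.foldr (matPderivOn X) F

theorem matMderivOn_cons (a : Fin n) (α : List (Fin n))
    (F : (Fin n → ℝ) → Matrix (Fin N) (Fin N) ℂ) :
    matMderivOn X (a :: α) F = matPderivOn X a (matMderivOn X α F) := rfl

theorem matMderivOn_apply (α : List (Fin n)) (F : (Fin n → ℝ) → Matrix (Fin N) (Fin N) ℂ)
    (x : Fin n → ℝ) (i j : Fin N) :
    matMderivOn X α F x i j = mderivOn X α (fun y => F y i j) x := by
  induction α generalizing x with
  | nil => rfl
  | cons a α ih =>
    rw [mderivOn_cons, ← funext fun y => ih y]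
    rfl

variable {F G : (Fin n → ℝ) → Matrix (Fin N) (Fin N) ℂ}

theorem EntrySmoothOn.mul (hF : EntrySmoothOn X F) (hG : EntrySmoothOn X G) :
    EntrySmoothOn X (fun x => F x * G x) := fun i j => by
  simp only [Matrix.mul_apply]
  exact ContDiffOn.sum fun l _ => (hF i l).mul (hG l j)

theorem EntrySmoothOn.matMderivOn (hF : EntrySmoothOn X F) (hX : IsOpen X) (α : List (Fin n)) :
    EntrySmoothOn X (matMderivOn X α F) := fun i j => by
  simp only [matMderivOn_apply]
  exact (hF i j).mderivOn hX α

theorem EntrySmoothOn.continuousAt (hF : EntrySmoothOn X F) (hX : IsOpen X) {x : Fin n → ℝ}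
    (hx : x ∈ X) : ContinuousAt F x :=
  continuousAt_pi.2 fun i => continuousAt_pi.2 fun j =>
    (hF i j).continuousOn.continuousAt (hX.mem_nhds hx)

theorem matMderivOn_perm (hF : EntrySmoothOn X F) (hX : IsOpen X) {α β : List (Fin n)}
    (h : α.Perm β) : Set.EqOn (matMderivOn X α F) (matMderivOn X β F) X := fun x hx => by
  ext i j
  simp only [matMderivOn_apply, mderivOn_perm (hF i j) hX h hx]

theorem matPderivOn_congr (h : Set.EqOn F G X) (a : Fin n) :
    Set.EqOn (matPderivOn X a F) (matPderivOn X a G) X := fun x hx => by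
  ext i j
  exact pderivOn_congr (fun y hy => by simp only [h hy]) a hx

theorem EntrySmoothOn.differentiableWithinAt (hF : EntrySmoothOn X F) {x : Fin n → ℝ}
    (hx : x ∈ X) (i j : Fin N) : DifferentiableWithinAt ℝ (fun y => F y i j) X x :=
  (hF i j).differentiableOn (by simp) x hx

theorem matPderivOn_add (hX : IsOpen X) (hF : EntrySmoothOn X F) (hG : EntrySmoothOn X G)
    (a : Fin n) {x : Fin n → ℝ} (hx : x ∈ X) :
    matPderivOn X a (fun y => F y + G y) x = matPderivOn X a F x + matPderivOn X a G x := by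
  ext i j
  simp only [matPderivOn, pderivOn, Matrix.of_apply, Matrix.add_apply]
  rw [fderivWithin_fun_add (hX.uniqueDiffWithinAt hx) (hF.differentiableWithinAt hx i j)
    (hG.differentiableWithinAt hx i j)]
  rfl

theorem matPderivOn_sub (hX : IsOpen X) (hF : EntrySmoothOn X F) (hG : EntrySmoothOn X G)
    (a : Fin n) {x : Fin n → ℝ} (hx : x ∈ X) :
    matPderivOn X a (fun y => F y - G y) x = matPderivOn X a F x - matPderivOn X a G x := by
  ext i j
  simp only [matPderivOn, pderivOn, Matrix.of_apply, Matrix.sub_apply]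
  rw [fderivWithin_fun_sub (hX.uniqueDiffWithinAt hx) (hF.differentiableWithinAt hx i j)
    (hG.differentiableWithinAt hx i j)]
  rfl

theorem matPderivOn_mul (hX : IsOpen X) (hF : EntrySmoothOn X F) (hG : EntrySmoothOn X G)
    (a : Fin n) {x : Fin n → ℝ} (hx : x ∈ X) :
    matPderivOn X a (fun y => F y * G y) x =
      matPderivOn X a F x * G x + F x * matPderivOn X a G x := by
  ext i j
  simp only [matPderivOn, pderivOn, Matrix.of_apply, Matrix.add_apply, Matrix.mul_apply]
  rw [fderivWithin_fun_sum (hX.uniqueDiffWithinAt hx) fun l _ =>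
    (hF.differentiableWithinAt hx i l).fun_mul (hG.differentiableWithinAt hx l j)]
  simp only [sum_apply, ← Finset.sum_add_distrib]
  refine Finset.sum_congr rfl fun l _ => ?_
  rw [fderivWithin_fun_mul (hX.uniqueDiffWithinAt hx) (hF.differentiableWithinAt hx i l)
    (hG.differentiableWithinAt hx l j)]
  simp only [add_apply, smul_apply, smul_eq_mul]
  ring

theorem EntrySmoothOn.list_sum {ι : Type*} (l : List ι)
    {H : ι → (Fin n → ℝ) → Matrix (Fin N) (Fin N) ℂ} (hH : ∀ r ∈ l, EntrySmoothOn X (H r)) :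
    EntrySmoothOn X (fun y => (l.map fun r => H r y).sum) := by
  induction l with
  | nil => exact fun _ _ => contDiffOn_const
  | cons r l ih =>
    simp only [List.forall_mem_cons] at hH
    simp only [List.map_cons, List.sum_cons]
    exact fun i j => (hH.1 i j).add (ih hH.2 i j)

theorem matPderivOn_list_sum {ι : Type*} (hX : IsOpen X) (l : List ι)
    {H : ι → (Fin n → ℝ) → Matrix (Fin N) (Fin N) ℂ} (hH : ∀ r ∈ l, EntrySmoothOn X (H r))
    (a : Fin n) {x : Fin n → ℝ} (hx : x ∈ X) :
    matPderivOn X a (fun y => (l.map fun r => H r y).sum) x =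
      (l.map fun r => matPderivOn X a (H r) x).sum := by
  induction l with
  | nil =>
    ext i j
    simp [matPderivOn, pderivOn]
  | cons r l ih =>
    simp only [List.forall_mem_cons] at hH
    simp only [List.map_cons, List.sum_cons]
    rw [matPderivOn_add hX hH.1 (EntrySmoothOn.list_sum l hH.2) a hx, ih hH.2]

theorem matMderivOn_sub (hX : IsOpen X) (hF : EntrySmoothOn X F) (hG : EntrySmoothOn X G)
    (α : List (Fin n)) {x : Fin n → ℝ} (hx : x ∈ X) :
    matMderivOn X α (fun y => F y - G y) x = matMderivOn X α F x - matMderivOn X α G x := by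
  induction α generalizing x with
  | nil => rfl
  | cons a α ih =>
    rw [matMderivOn_cons, matPderivOn_congr (fun y hy => ih hy) a hx,
      matPderivOn_sub hX (hF.matMderivOn hX α) (hG.matMderivOn hX α) a hx]
    rfl

/-- All ways of extracting one element from a list. -/
def List.extractions {ι : Type*} : List ι → List (ι × List ι)
  | [] => []
  | a :: l => (a, l) :: l.extractions.map fun r => (r.1, a :: r.2)

theorem List.perm_of_mem_extractions {ι : Type*} {l : List ι} {r : ι × List ι}
    (hr : r ∈ l.extractions) : l.Perm (r.1 :: r.2) := by
  induction l generalizing r with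
  | nil => simp [List.extractions] at hr
  | cons a l ih =>
    simp only [List.extractions, List.mem_cons, List.mem_map] at hr
    rcases hr with rfl | ⟨s, hs, rfl⟩
    · exact List.Perm.refl _
    · exact ((ih hs).cons a).trans (List.Perm.swap _ _ _)

/-- Leibniz formula for iterated derivatives of a matrix product, in which only the terms with at
most one derivative on the first factor are made explicit. -/
theorem exists_matMderivOn_mul (hX : IsOpen X) (α : List (Fin n)) :
    ∃ R : List (List (Fin n) × List (Fin n)), (∀ r ∈ R, r.2.length + 2 ≤ α.length) ∧
      ∀ F G : (Fin n → ℝ) → Matrix (Fin N) (Fin N) ℂ, EntrySmoothOn X F → EntrySmoothOn X G →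
        ∀ x ∈ X, matMderivOn X α (fun y => F y * G y) x = F x * matMderivOn X α G x +
          (α.extractions.map fun r => matMderivOn X [r.1] F x * matMderivOn X r.2 G x).sum +
          (R.map fun r => matMderivOn X r.1 F x * matMderivOn X r.2 G x).sum := by
  induction α with
  | nil => exact ⟨[], by simp, fun F G _ _ x _ => by simp [matMderivOn, List.extractions]⟩
  | cons a α ih =>
    obtain ⟨R, hR, h⟩ := ih
    refine ⟨α.extractions.map (fun r => ([a, r.1], r.2)) ++
      (R.map (fun r => (a :: r.1, r.2)) ++ R.map fun r => (r.1, a :: r.2)), ?_, ?_⟩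
    · intro r hr
      simp only [List.mem_append, List.mem_map] at hr
      rcases hr with ⟨s, hs, rfl⟩ | ⟨s, hs, rfl⟩ | ⟨s, hs, rfl⟩
      · have := (List.perm_of_mem_extractions hs).length_eq
        simp only [List.length_cons] at this ⊢
        omega
      · have := hR s hs
        simp only [List.length_cons] at this ⊢
        omega
      · have := hR s hs
        simp only [List.length_cons] at this ⊢
        omega
    · intro F G hF hG x hx
      have hFs := fun β => hF.matMderivOn hX β
      have hGs := fun β => hG.matMderivOn hX β
      have h₁ : EntrySmoothOn X fun y => F y * matMderivOn X α G y := hF.mul (hGs α)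
      have h₂ : ∀ r ∈ α.extractions, EntrySmoothOn X fun y =>
        matMderivOn X [r.1] F y * matMderivOn X r.2 G y := fun r _ => (hFs _).mul (hGs _)
      have h₃ : ∀ r ∈ R, EntrySmoothOn X fun y =>
        matMderivOn X r.1 F y * matMderivOn X r.2 G y := fun r _ => (hFs _).mul (hGs _)
      have h₂' := EntrySmoothOn.list_sum _ h₂
      have h₃' := EntrySmoothOn.list_sum _ h₃
      have h₁₂ : EntrySmoothOn X fun y => F y * matMderivOn X α G y +
          (α.extractions.map fun r => matMderivOn X [r.1] F y * matMderivOn X r.2 G y).sum :=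
        fun i j => (h₁ i j).add (h₂' i j)
      rw [matMderivOn_cons, matPderivOn_congr (h F G hF hG) a hx,
        matPderivOn_add hX h₁₂ h₃' a hx, matPderivOn_add hX h₁ h₂' a hx,
        matPderivOn_list_sum hX _ h₂ a hx, matPderivOn_list_sum hX _ h₃ a hx,
        matPderivOn_mul hX hF (hGs α) a hx]
      simp only [matPderivOn_mul hX (hFs _) (hGs _) a hx, List.sum_map_add, ← matMderivOn_cons,
        List.extractions, List.map_cons, List.sum_cons, List.map_append, List.sum_append,
        List.map_map, Function.comp_def]
      rw [show matMderivOn X [a] F = matPderivOn X a F from rfl]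
      abel

end MatrixValued
section Borel

open scoped Nat ContDiff

variable {n : ℕ}

/-- The monomial centred at `γ` with exponents the multiplicities of `s`, divided by the product of
the factorials of the exponents. -/
noncomputable def dividedMonomial (γ : Fin n → ℝ) (s : Multiset (Fin n)) (x : Fin n → ℝ) : ℂ :=
  ∏ i, ((x i - γ i : ℝ) : ℂ) ^ s.count i / ((s.count i)! : ℂ)

theorem contDiff_dividedMonomial (γ : Fin n → ℝ) (s : Multiset (Fin n)) :
    ContDiff ℝ ∞ (dividedMonomial γ s) := by
  unfold dividedMonomial
  refine contDiff_prod fun i _ => ContDiff.div_const (ContDiff.pow ?_ _) _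
  exact Complex.ofRealCLM.contDiff.comp ((contDiff_apply ℝ ℝ i).sub contDiff_const)

theorem dividedMonomial_self (γ : Fin n → ℝ) (s : Multiset (Fin n)) :
    dividedMonomial γ s γ = if s = 0 then 1 else 0 := by
  split_ifs with h
  · simp [dividedMonomial, h]
  · obtain ⟨a, ha⟩ := Multiset.exists_mem_of_ne_zero h
    refine Finset.prod_eq_zero (Finset.mem_univ a) ?_
    simp [Multiset.count_ne_zero.2 ha]

theorem dividedMonomial_smul (t : ℝ) (s : Multiset (Fin n)) (y : Fin n → ℝ) :
    dividedMonomial 0 s (t • y) = (t : ℂ) ^ s.card * dividedMonomial 0 s y := by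
  have h : (t : ℂ) ^ s.card = ∏ i, (t : ℂ) ^ s.count i := by
    rw [Finset.prod_pow_eq_pow_sum, Multiset.sum_count_eq_card fun _ _ => Finset.mem_univ _]
  rw [h, dividedMonomial, dividedMonomial, ← Finset.prod_mul_distrib]
  refine Finset.prod_congr rfl fun i _ => ?_
  simp only [Pi.smul_apply, smul_eq_mul, Pi.zero_apply, sub_zero, Complex.ofReal_mul, mul_pow]
  ring

theorem hasDerivAt_pow_div_factorial (k : ℕ) (b : ℝ) :
    HasDerivAt (fun t : ℝ => ((b + t : ℝ) : ℂ) ^ k / (k ! : ℂ))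
      (if k = 0 then 0 else (b : ℂ) ^ (k - 1) / ((k - 1)! : ℂ)) 0 := by
  have h : HasDerivAt (fun t : ℝ => ((b + t : ℝ) : ℂ)) 1 0 := by
    simpa using ((hasDerivAt_id (0 : ℝ)).const_add b).ofReal_comp
  cases k with
  | zero => simpa using hasDerivAt_const (0 : ℝ) (1 : ℂ)
  | succ k =>
    refine ((h.fun_pow (k + 1)).div_const ((k + 1)! : ℂ)).congr_deriv ?_
    have h₁ : ((k : ℂ) + 1) ≠ 0 := by exact_mod_cast Nat.succ_ne_zero k
    have h₂ : (k ! : ℂ) ≠ 0 := by exact_mod_cast Nat.factorial_ne_zero k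
    simp only [Nat.succ_ne_zero, if_false, Nat.add_sub_cancel, Nat.factorial_succ, add_zero]
    push_cast
    field_simp

theorem pderivOn_dividedMonomial (γ : Fin n → ℝ) (a : Fin n) (s : Multiset (Fin n)) (c : ℂ) :
    pderivOn Set.univ a (fun x => c * dividedMonomial γ s x) =
      fun x => (if a ∈ s then c else 0) * dividedMonomial γ (s.erase a) x := by
  ext x
  have hd : DifferentiableAt ℝ (fun x => c * dividedMonomial γ s x) x :=
    ((contDiff_const.mul (contDiff_dividedMonomial γ s)).differentiable (by simp)) x
  rw [pderivOn, fderivWithin_univ, ← hd.lineDeriv_eq_fderiv, lineDeriv]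
  refine HasDerivAt.deriv ?_
  have h := ((hasDerivAt_pow_div_factorial (s.count a) (x a - γ a)).mul_const
    (∏ i ∈ Finset.univ.erase a, ((x i - γ i : ℝ) : ℂ) ^ s.count i / ((s.count i)! : ℂ))).const_mul c
  refine (h.congr_deriv ?_).congr_of_eventuallyEq (.of_forall fun t => ?_)
  rotate_left
  · simp only
    rw [dividedMonomial, ← Finset.mul_prod_erase _ _ (Finset.mem_univ a)]
    congr 2
    · simp [add_sub_right_comm]
    · refine Finset.prod_congr rfl fun i hi => ?_
      simp [Finset.ne_of_mem_erase hi]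
  · rw [dividedMonomial, ← Finset.mul_prod_erase _ _ (Finset.mem_univ a)]
    have h' : ∏ i ∈ Finset.univ.erase a, ((x i - γ i : ℝ) : ℂ) ^ (s.erase a).count i /
        (((s.erase a).count i)! : ℂ) =
        ∏ i ∈ Finset.univ.erase a, ((x i - γ i : ℝ) : ℂ) ^ s.count i / ((s.count i)! : ℂ) :=
      Finset.prod_congr rfl fun i hi => by
        rw [Multiset.count_erase_of_ne (Finset.ne_of_mem_erase hi)]
    rw [h', Multiset.count_erase_self]
    by_cases ha : a ∈ s
    · simp [ha]
    · simp [ha]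

theorem mderivOn_append_singleton {X : Set (Fin n → ℝ)} (α : List (Fin n)) (a : Fin n)
    (f : (Fin n → ℝ) → ℂ) : mderivOn X (α ++ [a]) f = mderivOn X α (pderivOn X a f) := by
  simp [mderivOn]

theorem mderivOn_dividedMonomial (γ : Fin n → ℝ) (α : List (Fin n)) (s : Multiset (Fin n))
    (c : ℂ) : mderivOn Set.univ α (fun x => c * dividedMonomial γ s x) γ =
      if s = (α : Multiset (Fin n)) then c else 0 := by
  induction α using List.reverseRecOn generalizing s c with
  | nil => by_cases h : s = 0 <;> simp [mderivOn, dividedMonomial_self, h]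
  | append_singleton α a ih =>
    have h : ((α ++ [a] : List (Fin n)) : Multiset (Fin n)) = a ::ₘ (α : Multiset (Fin n)) := by
      rw [Multiset.cons_coe, Multiset.coe_eq_coe]
      exact List.perm_append_singleton a α
    rw [mderivOn_append_singleton, pderivOn_dividedMonomial, ih, h]
    by_cases ha : a ∈ s
    · have : s.erase a = (α : Multiset (Fin n)) ↔ s = a ::ₘ (α : Multiset (Fin n)) :=
        ⟨fun h => by rw [← h, Multiset.cons_erase ha], fun h => by simp [h]⟩
      rw [if_pos ha]
      exact if_congr this rfl rfl
    · have : s ≠ a ::ₘ (α : Multiset (Fin n)) := fun h => ha (by simp [h])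
      rw [if_neg ha, if_neg this, ite_self]

theorem exists_norm_iteratedFDeriv_le {E F : Type*} [NormedAddCommGroup E] [NormedSpace ℝ E]
    [NormedAddCommGroup F] [NormedSpace ℝ F] {u : E → F} (hu : ContDiff ℝ ∞ u)
    (hc : HasCompactSupport u) (k : ℕ) : ∃ C, ∀ x, ‖iteratedFDeriv ℝ k u x‖ ≤ C :=
  (hc.iteratedFDeriv k).exists_bound_of_continuous
    (hu.continuous_iteratedFDeriv (by exact_mod_cast le_top))

/-- A rescaling of a test function which makes all derivatives of order less than `m` small. -/
theorem exists_rescaling {E F : Type*} [NormedAddCommGroup E] [NormedSpace ℝ E]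
    [NormedAddCommGroup F] [NormedSpace ℝ F] {u : E → F} (hu : ContDiff ℝ ∞ u)
    (hc : HasCompactSupport u) (γ : E) (m : ℕ) {ε : ℝ} (hε : 0 < ε) :
    ∃ t : ℝ, 0 < t ∧ (∀ k < m, ∀ x,
        ‖iteratedFDeriv ℝ k (fun x => (t ^ m)⁻¹ • u (t • (x - γ))) x‖ ≤ ε) ∧
      ∀ k, ∃ B, ∀ x, ‖iteratedFDeriv ℝ k (fun x => (t ^ m)⁻¹ • u (t • (x - γ))) x‖ ≤ B := by
  choose C hC using exists_norm_iteratedFDeriv_le hu hc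
  have hC0 : ∀ k, 0 ≤ C k := fun k => (norm_nonneg _).trans (hC k 0)
  have hscale : ∀ t : ℝ, 0 < t → ∀ k x,
      ‖iteratedFDeriv ℝ k (fun x => (t ^ m)⁻¹ • u (t • (x - γ))) x‖ ≤
        (t ^ m)⁻¹ * (C k * t ^ k) := by
    intro t ht k x
    have hψ : ContDiff ℝ ∞ fun y => u (t • y) := hu.comp (contDiff_const_smul t)
    have hsm : ContDiff ℝ ∞ fun x => u (t • (x - γ)) := hψ.comp (contDiff_id.sub contDiff_const)
    have h₁ := iteratedFDeriv_const_smul_apply' (𝕜 := ℝ) (a := (t ^ m)⁻¹) (i := k) (x := x)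
      (hsm.of_le (by exact_mod_cast le_top)).contDiffAt
    rw [h₁, norm_smul, Real.norm_of_nonneg (by positivity)]
    gcongr
    rw [iteratedFDeriv_comp_sub (f := fun y => u (t • y))]
    have h₂ := (t • ContinuousLinearMap.id ℝ E).iteratedFDeriv_comp_right hu (x - γ) (i := k)
      (by exact_mod_cast le_top)
    change ‖iteratedFDeriv ℝ k (u ∘ (t • ContinuousLinearMap.id ℝ E)) (x - γ)‖ ≤ _
    rw [h₂]
    refine (ContinuousMultilinearMap.norm_compContinuousLinearMap_le _ _).trans ?_
    have hn : ‖t • ContinuousLinearMap.id ℝ E‖ ≤ t := by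
      rw [norm_smul, Real.norm_of_nonneg ht.le]
      exact mul_le_of_le_one_right ht.le ContinuousLinearMap.norm_id_le
    simp only [Finset.prod_const, Finset.card_univ, Fintype.card_fin]
    exact mul_le_mul (hC k _) (pow_le_pow_left₀ (norm_nonneg _) hn k) (by positivity) (hC0 k)
  have hsum : 0 ≤ ∑ k ∈ Finset.range m, C k := Finset.sum_nonneg fun k _ => hC0 k
  set t : ℝ := 1 + (∑ k ∈ Finset.range m, C k) / ε with ht
  have ht1 : 1 ≤ t := by
    rw [ht]
    exact le_add_of_nonneg_right (by positivity)
  have ht0 : 0 < t := by linarith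
  refine ⟨t, ht0, fun k hk x => (hscale t ht0 k x).trans ?_, fun k => ⟨_, hscale t ht0 k⟩⟩
  have hCk : C k ≤ ε * t := by
    have h₁ : C k ≤ ∑ k ∈ Finset.range m, C k :=
      Finset.single_le_sum (fun k _ => hC0 k) (Finset.mem_range.2 hk)
    have h₂ : ε * t = ε + ∑ k ∈ Finset.range m, C k := by
      rw [ht]
      field_simp
    linarith
  rw [inv_mul_le_iff₀ (by positivity)]
  calc C k * t ^ k ≤ ε * t * t ^ k := by gcongr
    _ = t ^ (k + 1) * ε := by ring
    _ ≤ t ^ m * ε := by gcongr; exact hk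

theorem exists_local_dividedMonomial (γ : Fin n → ℝ) (s : Multiset (Fin n)) (c : ℂ) {ε : ℝ}
    (hε : 0 < ε) : ∃ f : (Fin n → ℝ) → ℂ, ContDiff ℝ ∞ f ∧
      f =ᶠ[nhds γ] (fun x => c * dividedMonomial γ s x) ∧
      (∀ k < s.card, ∀ x, ‖iteratedFDeriv ℝ k f x‖ ≤ ε) ∧
      ∀ k, ∃ B, ∀ x, ‖iteratedFDeriv ℝ k f x‖ ≤ B := by
  let χ : ContDiffBump (0 : Fin n → ℝ) := ⟨1, 2, one_pos, one_lt_two⟩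
  have hu : ContDiff ℝ ∞ fun y => χ y • (c * dividedMonomial 0 s y) :=
    χ.contDiff.smul (contDiff_const.mul (contDiff_dividedMonomial 0 s))
  have hc : HasCompactSupport fun y => χ y • (c * dividedMonomial 0 s y) :=
    χ.hasCompactSupport.smul_right
  obtain ⟨t, ht, h₁, h₂⟩ := exists_rescaling hu hc γ s.card hε
  have hsm : ContDiff ℝ ∞ fun x : Fin n → ℝ => t • (x - γ) :=
    (contDiff_const_smul t).comp (contDiff_id.sub contDiff_const)
  refine ⟨_, (hu.comp hsm).const_smul (t ^ s.card)⁻¹, ?_, h₁, h₂⟩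
  have hcont : Tendsto (fun x => t • (x - γ)) (nhds γ) (nhds 0) := by
    have : Continuous fun x : Fin n → ℝ => t • (x - γ) := by fun_prop
    simpa using this.tendsto γ
  filter_upwards [hcont.eventually χ.eventuallyEq_one] with x hx
  have hx' : χ (t • (x - γ)) = 1 := hx
  have hm : dividedMonomial 0 s (x - γ) = dividedMonomial γ s x := by simp [dividedMonomial]
  have ht' : (t : ℂ) ≠ 0 := by exact_mod_cast ht.ne'
  simp only [Function.comp_apply]
  rw [hx', one_smul, dividedMonomial_smul, hm, Complex.real_smul]
  push_cast
  field_simp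

theorem finite_multiset_card_le (k : ℕ) : {s : Multiset (Fin n) | s.card ≤ k}.Finite := by
  refine (Set.finite_Icc 0 (k • (Finset.univ : Finset (Fin n)).val)).subset fun s hs => ?_
  refine ⟨zero_le, Multiset.le_iff_count.2 fun a => ?_⟩
  rw [Multiset.count_nsmul, Multiset.count_eq_one_of_mem Finset.univ.nodup (Finset.mem_univ a),
    mul_one]
  exact (Multiset.count_le_card a s).trans hs

/-- **Borel's theorem**: every jet at a point is the jet of a smooth function. -/
theorem exists_contDiff_mderivOn_eq (γ : Fin n → ℝ) (c : Multiset (Fin n) → ℂ) :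
    ∃ g : (Fin n → ℝ) → ℂ, ContDiff ℝ ∞ g ∧
      ∀ α : List (Fin n), mderivOn Set.univ α g γ = c α := by
  obtain ⟨ε, hε, _, hsum, _⟩ :=
    NNReal.exists_pos_sum_of_countable one_ne_zero (Multiset (Fin n))
  choose f hf heq hsmall B hB using fun s =>
    exists_local_dividedMonomial γ s (c s) (NNReal.coe_pos.2 (hε s))
  let v : ℕ → Multiset (Fin n) → ℝ := fun k s => if k < s.card then (ε s : ℝ) else B s k
  have hv : ∀ k : ℕ, (k : ℕ∞) ≤ ⊤ → Summable (v k) := by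
    intro k _
    refine (NNReal.summable_coe.2 hsum.summable).congr_cofinite ?_
    filter_upwards [(finite_multiset_card_le k).compl_mem_cofinite] with s hs
    have : k < s.card := by simpa using hs
    simp [v, this]
  have hbound : ∀ (k : ℕ) (s : Multiset (Fin n)) (x : Fin n → ℝ), (k : ℕ∞) ≤ ⊤ →
      ‖iteratedFDeriv ℝ k (f s) x‖ ≤ v k s := by
    intro k s x _
    by_cases h : k < s.card
    · simpa [v, h] using hsmall s k h x
    · simpa [v, h] using hB s k x
  have hg : ContDiff ℝ ∞ fun x => ∑' s, f s x := contDiff_tsum hf hv hbound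
  refine ⟨_, hg, fun α => ?_⟩
  have hs : Summable fun s => iteratedFDeriv ℝ α.length (f s) γ :=
    .of_norm_bounded (hv _ le_top) fun s => hbound _ s γ le_top
  rw [mderivOn_eq_iteratedFDeriv hg.contDiffOn isOpen_univ α (Set.mem_univ γ),
    iteratedFDeriv_tsum hf hv hbound le_top]
  have hmap := (ContinuousMultilinearMap.apply ℝ (fun _ : Fin α.length => Fin n → ℝ) ℂ
    fun i => Pi.single (α.get i) 1).map_tsum hs
  simp only [ContinuousMultilinearMap.apply_apply] at hmap
  rw [hmap, ← tsum_ite_eq (α : Multiset (Fin n)) c]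
  refine tsum_congr fun s => ?_
  rw [(Filter.EventuallyEq.iteratedFDeriv ℝ (heq s) α.length).eq_of_nhds, ← mderivOn_eq_iteratedFDeriv
    (contDiff_const.mul (contDiff_dividedMonomial γ s)).contDiffOn isOpen_univ α (Set.mem_univ γ),
    mderivOn_dividedMonomial]

end Borel

section Limits

variable {n N : ℕ} {X : Set (Fin n → ℝ)}

theorem exists_tendsto_of_tendsto_mul {ι : Type*} {l : Filter ι}
    {A G : ι → Matrix (Fin N) (Fin N) ℂ} {A₀ B : Matrix (Fin N) (Fin N) ℂ}
    (hA : Tendsto A l (nhds A₀)) (hA₀ : IsUnit A₀)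
    (hB : Tendsto (fun k => A k * G k) l (nhds B)) : ∃ L, Tendsto G l (nhds L) := by
  have hdet : Tendsto (fun k => (A k).det) l (nhds A₀.det) :=
    (continuous_id.matrix_det.tendsto A₀).comp hA
  have hadj : Tendsto (fun k => (A k).adjugate) l (nhds A₀.adjugate) :=
    (continuous_id.matrix_adjugate.tendsto A₀).comp hA
  have hne : A₀.det ≠ 0 := ((Matrix.isUnit_iff_isUnit_det A₀).1 hA₀).ne_zero
  refine ⟨_, ((hdet.inv₀ hne).smul (hadj.mul hB)).congr' ?_⟩
  filter_upwards [hdet.eventually_ne hne] with k hk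
  rw [← mul_assoc, Matrix.adjugate_mul, Matrix.smul_mul, one_mul, smul_smul, inv_mul_cancel₀ hk,
    one_smul]

theorem exists_list_sum_eq_smul_add {ι κ : Type*} {M : Type*} [TopologicalSpace M] [Ring M]
    [IsTopologicalRing M] {f : Filter ι} (A : κ → ι → M) (G : List κ → ι → M) (e : κ) (α : List κ)
    (hA : ∀ a, ∃ L, Tendsto (A a) f (nhds L)) (l : List (κ × List κ))
    (hl : ∀ r ∈ l, (r.1 = e ∧ G r.2 = G α) ∨ ∃ L, Tendsto (G r.2) f (nhds L)) :
    ∃ (c : ℕ) (B : ι → M) (L : M), Tendsto B f (nhds L) ∧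
      ∀ k, (l.map fun r => A r.1 k * G r.2 k).sum = c • (A e k * G α k) + B k := by
  induction l with
  | nil => exact ⟨0, 0, 0, tendsto_const_nhds, fun k => by simp⟩
  | cons r l ih =>
    rw [List.forall_mem_cons] at hl
    obtain ⟨c, B, L, hB, h⟩ := ih hl.2
    rcases hl.1 with ⟨h₁, h₂⟩ | ⟨L', hL'⟩
    · refine ⟨c + 1, B, L, hB, fun k => ?_⟩
      rw [List.map_cons, List.sum_cons, h, h₁, h₂, succ_nsmul']
      abel
    · obtain ⟨L'', hL''⟩ := hA r.1
      refine ⟨c, fun k => A r.1 k * G r.2 k + B k, _, (hL''.mul hL').add hB, fun k => ?_⟩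
      rw [List.map_cons, List.sum_cons, h]
      exact add_left_comm _ _ _

variable {p : (Fin n → ℝ) → Matrix (Fin N) (Fin N) ℂ}
  {qs gs : ℕ → (Fin n → ℝ) → Matrix (Fin N) (Fin N) ℂ} {γ : Fin n → ℝ} {γs : ℕ → Fin n → ℝ}

theorem tendsto_matMderivOn (hX : IsOpen X) (hγ : γ ∈ X) (htend : Tendsto γs atTop (nhds γ))
    (hp : EntrySmoothOn X p) (α : List (Fin n)) :
    Tendsto (fun k => matMderivOn X α p (γs k)) atTop (nhds (matMderivOn X α p γ)) :=
  ((hp.matMderivOn hX α).continuousAt hX hγ).tendsto.comp htend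

theorem exists_tendsto_matMderivOn (e : Fin n) (hX : IsOpen X) (hγ : γ ∈ X)
    (hγs : ∀ k, γs k ∈ X) (htend : Tendsto γs atTop (nhds γ)) (hp : EntrySmoothOn X p)
    (hqs : ∀ k, EntrySmoothOn X (qs k)) (hgs : ∀ k, EntrySmoothOn X (gs k))
    (hp0 : ∀ k, p (γs k) = 0) (hinv : IsUnit (matMderivOn X [e] p γ))
    (hqlim : ∀ α, ∃ L, Tendsto (fun k => matMderivOn X α (qs k) (γs k)) atTop (nhds L))
    (hflat : ∀ k α, matMderivOn X α (fun y => qs k y - p y * gs k y) (γs k) = 0)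
    (α : List (Fin n)) :
    ∃ L, Tendsto (fun k => matMderivOn X α (gs k) (γs k)) atTop (nhds L) := by
  induction hm : α.length using Nat.strong_induction_on generalizing α with
  | _ m ihm =>
  subst hm
  induction hd : α.length - α.count e using Nat.strong_induction_on generalizing α with
  | _ d ihd =>
  subst hd
  obtain ⟨R, hR, hleib⟩ := exists_matMderivOn_mul (N := N) hX (e :: α)
  have hpl := tendsto_matMderivOn hX hγ htend hp
  obtain ⟨c, B, L, hB, hsum⟩ := exists_list_sum_eq_smul_add
    (fun a k => matMderivOn X [a] p (γs k)) (fun β k => matMderivOn X β (gs k) (γs k)) e α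
    (fun a => ⟨_, hpl [a]⟩) (α.extractions.map fun r => (r.1, e :: r.2)) (by
      intro r hr
      obtain ⟨s, hs, rfl⟩ := List.mem_map.1 hr
      have hperm := List.perm_of_mem_extractions hs
      have hlen := hperm.length_eq
      simp only [List.length_cons] at hlen
      by_cases hse : s.1 = e
      · rw [hse] at hperm
        exact .inl ⟨hse, funext fun k => matMderivOn_perm (hgs k) hX hperm.symm (hγs k)⟩
      · have hcount : (e :: s.2).count e = α.count e + 1 := by
          rw [hperm.count_eq, List.count_cons_self, List.count_cons_of_ne hse]
        have hle : (e :: s.2).count e ≤ (e :: s.2).length := List.count_le_length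
        simp only [List.length_cons] at hle
        exact .inr (ihd _ (by simp only [List.length_cons]; omega) (e :: s.2)
          (fun m hm => ihm m (by simp only [List.length_cons] at hm; omega)) rfl))
  have hRlim : ∃ L, Tendsto (fun k => (R.map fun r => matMderivOn X r.1 p (γs k) *
      matMderivOn X r.2 (gs k) (γs k)).sum) atTop (nhds L) := by
    have : ∀ r ∈ R, ∃ L, Tendsto (fun k => matMderivOn X r.2 (gs k) (γs k)) atTop (nhds L) :=
      fun r hr => ihm _ (by have := hR r hr; simp only [List.length_cons] at this; omega) r.2 rfl
    choose! L hL using this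
    exact ⟨_, tendsto_list_sum R fun r hr => (hpl r.1).mul (hL r hr)⟩
  obtain ⟨LR, hLR⟩ := hRlim
  obtain ⟨Lq, hLq⟩ := hqlim (e :: α)
  have hc : ((c + 1 : ℕ) : ℂ) ≠ 0 := by exact_mod_cast Nat.succ_ne_zero c
  refine exists_tendsto_of_tendsto_mul (hpl [e]) hinv
    ((((hLq.sub hB).sub hLR).const_smul ((c + 1 : ℕ) : ℂ)⁻¹).congr fun k => ?_)
  have hk := hflat k (e :: α)
  rw [matMderivOn_sub hX (hqs k) (hp.mul (hgs k)) (e :: α) (hγs k), sub_eq_zero,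
    hleib p (gs k) hp (hgs k) _ (hγs k), hp0, zero_mul, zero_add] at hk
  have hs := hsum k
  simp only [List.map_map, Function.comp_def] at hs
  simp only [List.extractions, List.map_cons, List.sum_cons, List.map_map, Function.comp_def,
    hs] at hk
  rw [inv_smul_eq_iff₀ hc, Nat.cast_smul_eq_nsmul, hk, succ_nsmul']
  abel

end Limits

/-- principal-type division with limits. If `p(γ) = p(γ_j) = 0`,
`∂_{x₁} p(γ)` is invertible, the derivatives of `q_j` at `γ_j` converge to those of `q`
at `γ`, and `q_j − p g_j` is flat at `γ_j`, then all limits `lim_j ∂^α g_j(γ_j)` exist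
and there is a smooth `g` with these derivatives at `γ` such that `q − p g` is flat at `γ`. -/
theorem stmt_10 {n N : ℕ} (hn : 0 < n) (X : Set (Fin n → ℝ)) (hX : IsOpen X)
    (p q : (Fin n → ℝ) → Matrix (Fin N) (Fin N) ℂ)
    (qs gs : ℕ → (Fin n → ℝ) → Matrix (Fin N) (Fin N) ℂ)
    (γ : Fin n → ℝ) (γs : ℕ → Fin n → ℝ)
    (hγ : γ ∈ X) (hγs : ∀ j, γs j ∈ X)
    (htend : Tendsto γs atTop (nhds γ))
    (hp : ContDiffOn ℝ (⊤ : ℕ∞) (fun x => (fun i j => p x i j : Fin N → Fin N → ℂ)) X)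
    (hq : ContDiffOn ℝ (⊤ : ℕ∞) (fun x => (fun i j => q x i j : Fin N → Fin N → ℂ)) X)
    (hqs : ∀ k, ContDiffOn ℝ (⊤ : ℕ∞) (fun x => (fun i j => qs k x i j : Fin N → Fin N → ℂ)) X)
    (hgs : ∀ k, ContDiffOn ℝ (⊤ : ℕ∞) (fun x => (fun i j => gs k x i j : Fin N → Fin N → ℂ)) X)
    (hp0 : p γ = 0) (hpj : ∀ j, p (γs j) = 0)
    (hinv : IsUnit (Matrix.of fun i j => pderivOn X ⟨0, hn⟩ (fun x => p x i j) γ))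
    (hqlim : ∀ (α : List (Fin n)) (i j : Fin N),
      Tendsto (fun k => mderivOn X α (fun x => qs k x i j) (γs k)) atTop
        (nhds (mderivOn X α (fun x => q x i j) γ)))
    (hflat : ∀ (k : ℕ) (α : List (Fin n)) (i j : Fin N),
      mderivOn X α (fun x => (qs k x - p x * gs k x) i j) (γs k) = 0) :
    (∀ (α : List (Fin n)) (i j : Fin N), ∃ L : ℂ,
      Tendsto (fun k => mderivOn X α (fun x => gs k x i j) (γs k)) atTop (nhds L)) ∧
    ∃ g : (Fin n → ℝ) → Matrix (Fin N) (Fin N) ℂ,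
      ContDiffOn ℝ (⊤ : ℕ∞) (fun x => (fun i j => g x i j : Fin N → Fin N → ℂ)) X ∧
      (∀ (α : List (Fin n)) (i j : Fin N),
        mderivOn X α (fun x => (q x - p x * g x) i j) γ = 0) ∧
      (∀ (α : List (Fin n)) (i j : Fin N),
        Tendsto (fun k => mderivOn X α (fun x => gs k x i j) (γs k)) atTop
          (nhds (mderivOn X α (fun x => g x i j) γ))) := by
  have entry : ∀ {F : (Fin n → ℝ) → Matrix (Fin N) (Fin N) ℂ},
      ContDiffOn ℝ (⊤ : ℕ∞) (fun x => (fun i j => F x i j : Fin N → Fin N → ℂ)) X →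
        EntrySmoothOn X F :=
    fun h i j => contDiffOn_pi.1 (contDiffOn_pi.1 h i) j
  have hp' := entry hp
  have hq' := entry hq
  have hqs' := fun k => entry (hqs k)
  have hgs' := fun k => entry (hgs k)
  have hqlim' : ∀ α, Tendsto (fun k => matMderivOn X α (qs k) (γs k)) atTop
      (nhds (matMderivOn X α q γ)) := fun α =>
    tendsto_pi_nhds.2 fun i => tendsto_pi_nhds.2 fun j => by
      simpa only [matMderivOn_apply] using hqlim α i j
  have hflat' : ∀ k α, matMderivOn X α (fun y => qs k y - p y * gs k y) (γs k) = 0 := by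
    intro k α
    ext i j
    rw [matMderivOn_apply]
    exact hflat k α i j
  choose L hL using exists_tendsto_matMderivOn ⟨0, hn⟩ hX hγ hγs htend hp' hqs' hgs' hpj hinv
    (fun α => ⟨_, hqlim' α⟩) hflat'
  have hLentry : ∀ α i j, Tendsto (fun k => mderivOn X α (fun x => gs k x i j) (γs k)) atTop
      (nhds (L α i j)) := fun α i j => by
    simpa only [matMderivOn_apply] using tendsto_pi_nhds.1 (tendsto_pi_nhds.1 (hL α) i) j
  have hLperm : ∀ {α β : List (Fin n)}, α.Perm β → L α = L β := fun h =>
    tendsto_nhds_unique (hL _)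
      ((hL _).congr fun k => matMderivOn_perm (hgs' k) hX h.symm (hγs k))
  choose g hg hgjet using fun i j =>
    exists_contDiff_mderivOn_eq γ fun s : Multiset (Fin n) => L s.toList i j
  have hgL : ∀ α i j, mderivOn X α (g i j) γ = L α i j := fun α i j => by
    rw [mderivOn_eq_iteratedFDeriv (hg i j).contDiffOn hX α hγ,
      ← mderivOn_eq_iteratedFDeriv (hg i j).contDiffOn isOpen_univ α (Set.mem_univ γ), hgjet,
      hLperm (Multiset.coe_eq_coe.1 (Multiset.coe_toList _))]
  let G : (Fin n → ℝ) → Matrix (Fin N) (Fin N) ℂ := fun x => Matrix.of fun i j => g i j x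
  have hG : EntrySmoothOn X G := fun i j => (hg i j).contDiffOn
  have hGL : ∀ α, matMderivOn X α G γ = L α := fun α => by
    ext i j
    rw [matMderivOn_apply]
    exact hgL α i j
  refine ⟨fun α i j => ⟨_, hLentry α i j⟩, G,
    contDiffOn_pi.2 fun i => contDiffOn_pi.2 fun j => hG i j, fun α i j => ?_, fun α i j => ?_⟩
  · rw [← matMderivOn_apply α (fun x => q x - p x * G x)]
    suffices h : matMderivOn X α (fun x => q x - p x * G x) γ = 0 by rw [h]; rfl
    obtain ⟨R, -, hleib⟩ := exists_matMderivOn_mul (N := N) hX α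
    have hpl := tendsto_matMderivOn hX hγ htend hp'
    have hlim : Tendsto (fun k => matMderivOn X α (fun y => qs k y - p y * gs k y) (γs k)) atTop
        (nhds (matMderivOn X α (fun x => q x - p x * G x) γ)) := by
      rw [matMderivOn_sub hX hq' (hp'.mul hG) α hγ, hleib p G hp' hG γ hγ]
      simp only [hGL]
      refine ((hqlim' α).sub ((((hpl []).mul (hL α)).add (tendsto_list_sum _ fun r _ =>
        (hpl [r.1]).mul (hL r.2))).add (tendsto_list_sum _ fun r _ =>
        (hpl r.1).mul (hL r.2)))).congr fun k => ?_
      rw [matMderivOn_sub hX (hqs' k) (hp'.mul (hgs' k)) α (hγs k),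
        hleib p (gs k) hp' (hgs' k) _ (hγs k)]
      rfl
    simp only [hflat'] at hlim
    exact tendsto_nhds_unique hlim tendsto_const_nhds
  · change Tendsto _ _ (nhds (mderivOn X α (g i j) γ))
    rw [hgL]
    exact hLentry α i j
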